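/- arXiv:1501.01198 — 2 statements merged into one kernel-verified Lean document; each statement's English description precedes it below -/
import Mathlib

section
/- Let n ≥ 1 and let 𝓑 ⊆ {2, 3, 4, …} be a set of pairwise coprime integers with Σ_{b ∈ 𝓑} 1/bⁿ < ∞, and let V = ℤⁿ \ ⋃_{b ∈ 𝓑} bℤⁿ be the set of 𝓑-free lattice points. Then the natural density of V exists and equals the convergent product ∏_{b ∈ 𝓑} (1 − 1/bⁿ): lim_{R→∞} |V ∩ B_R(0)| / vol(B_R(0)) = ∏_{b ∈ 𝓑} (1 − b^{−n}). -/
open Filter Topology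

namespace BFree
open MeasureTheory
open scoped Pointwise

/-- lattice points of the open ball of radius `R` -/
def lb (n : ℕ) (R : ℝ) : Set (Fin n → ℤ) := {x | ∑ i, ((x i : ℝ))^2 < R^2}

lemma abs_lt_of_mem {n : ℕ} {R : ℝ} (hR : 0 < R) {x : Fin n → ℤ} (hx : x ∈ lb n R) (i : Fin n) :
    |(x i : ℝ)| < R := by
  have h : ((x i : ℝ))^2 ≤ ∑ i, ((x i : ℝ))^2 :=
    Finset.single_le_sum (f := fun i => ((x i : ℝ))^2) (fun _ _ => sq_nonneg _) (Finset.mem_univ i)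
  exact abs_lt_of_sq_lt_sq (lt_of_le_of_lt h hx) hR.le

lemma lb_subset (n : ℕ) {R : ℝ} (hR : 0 < R) :
    lb n R ⊆ ((Fintype.piFinset fun _ : Fin n => Finset.Icc (-⌊R⌋) ⌊R⌋ : Finset (Fin n → ℤ)) :
      Set (Fin n → ℤ)) := by
  intro x hx
  simp only [Finset.mem_coe, Fintype.mem_piFinset, Finset.mem_Icc]
  intro i
  have := abs_lt.1 (abs_lt_of_mem hR hx i)
  constructor
  · have : -x i ≤ ⌊R⌋ := Int.le_floor.2 (by push_cast; linarith)
    linarith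
  · exact Int.le_floor.2 this.2.le

lemma lb_finite (n : ℕ) {R : ℝ} (hR : 0 < R) : (lb n R).Finite :=
  (Finset.finite_toSet _).subset (lb_subset n hR)

lemma lb_ncard_le (n : ℕ) {R : ℝ} (hR : 1 ≤ R) : ((lb n R).ncard : ℝ) ≤ (3 * R) ^ n := by
  have h := Set.ncard_le_ncard (lb_subset n (by linarith : 0 < R)) (Finset.finite_toSet _)
  rw [Set.ncard_coe_finset, Fintype.card_piFinset] at h
  simp only [Int.card_Icc, Finset.prod_const, Finset.card_univ, Fintype.card_fin] at h
  have hf : (1 : ℤ) ≤ ⌊R⌋ := Int.le_floor.2 (by simpa using hR)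
  calc ((lb n R).ncard : ℝ) ≤ (((⌊R⌋ + 1 - -⌊R⌋).toNat ^ n : ℕ) : ℝ) := by exact_mod_cast h
    _ = (((⌊R⌋ + 1 - -⌊R⌋).toNat : ℝ)) ^ n := by push_cast; rfl
    _ ≤ _ := by
      apply pow_le_pow_left₀ (by positivity)
      have : (((⌊R⌋ + 1 - -⌊R⌋).toNat : ℤ) : ℝ) = (⌊R⌋ + 1 - -⌊R⌋ : ℤ) := by
        rw [Int.toNat_of_nonneg (by linarith)]
      rw [Int.cast_natCast] at this
      rw [this]
      push_cast
      have := Int.floor_le R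
      linarith

/-- divisibility of lattice points -/
def dv {n : ℕ} (d : ℕ) (x : Fin n → ℤ) : Prop := ∃ y : Fin n → ℤ, x = (d : ℤ) • y

lemma dv_iff {n : ℕ} (d : ℕ) (x : Fin n → ℤ) : dv d x ↔ ∀ i, (d : ℤ) ∣ x i := by
  constructor
  · rintro ⟨y, rfl⟩ i
    simp
  · intro h
    choose y hy using h
    exact ⟨y, by ext i; simp [hy i]⟩

lemma dv_mul {n : ℕ} {a b : ℕ} (h : Nat.Coprime a b) (x : Fin n → ℤ) :
    dv (a * b) x ↔ dv a x ∧ dv b x := by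
  simp only [dv_iff]
  constructor
  · intro hx
    push_cast at hx
    exact ⟨fun i => (Dvd.intro _ rfl).trans (hx i), fun i => (Dvd.intro_left _ rfl).trans (hx i)⟩
  · rintro ⟨h1, h2⟩ i
    push_cast
    exact IsCoprime.mul_dvd (Nat.isCoprime_iff_coprime.2 h) (h1 i) (h2 i)

lemma dv_set {n d : ℕ} (hd : 0 < d) (R : ℝ) :
    {x : Fin n → ℤ | dv d x ∧ x ∈ lb n R} = (fun y => (d : ℤ) • y) '' lb n (R / d) := by
  have hd' : (0 : ℝ) < d := by exact_mod_cast hd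
  have key : ∀ y : Fin n → ℤ, ((d : ℤ) • y ∈ lb n R ↔ y ∈ lb n (R / d)) := by
    intro y
    simp only [lb, Set.mem_ofPred_eq, Pi.smul_apply, smul_eq_mul, Int.cast_mul, mul_pow,
      ← Finset.mul_sum, div_pow, Int.cast_natCast]
    rw [lt_div_iff₀ (by positivity), mul_comm]
  ext x
  constructor
  · rintro ⟨⟨y, rfl⟩, h⟩
    exact ⟨y, (key y).1 h, rfl⟩
  · rintro ⟨y, h, rfl⟩
    exact ⟨⟨y, rfl⟩, (key y).2 h⟩

lemma smul_inj {n d : ℕ} (hd : 0 < d) : Function.Injective (fun y : Fin n → ℤ => (d : ℤ) • y) := by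
  intro x y h
  ext i
  have := congrFun h i
  simp only [Pi.smul_apply, smul_eq_mul] at this
  exact mul_left_cancel₀ (by exact_mod_cast hd.ne') this

lemma dv_ncard {n d : ℕ} (hd : 0 < d) (R : ℝ) :
    {x : Fin n → ℤ | dv d x ∧ x ∈ lb n R}.ncard = (lb n (R / d)).ncard := by
  rw [dv_set hd, Set.ncard_image_of_injective _ (smul_inj hd)]

lemma dv_ne_zero {n d : ℕ} (hd : 0 < d) {R : ℝ} (hR : 0 < R) {x : Fin n → ℤ} (hx : x ∈ lb n R)
    (h : dv d x) (h0 : x ≠ 0) : (d : ℝ) ≤ R := by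
  obtain ⟨i, hi⟩ := Function.ne_iff.1 h0
  have h1 := abs_lt_of_mem hR hx i
  have h2 := Int.le_of_dvd (abs_pos.2 hi) ((dvd_abs _ _).2 ((dv_iff d x).1 h i))
  have : ((d : ℤ) : ℝ) ≤ ((|x i| : ℤ) : ℝ) := by exact_mod_cast h2
  rw [Int.cast_abs] at this
  rw [Int.cast_natCast] at this
  linarith

/-- the volume of the unit ball -/
noncomputable def cv (n : ℕ) : ℝ := (volume (Metric.ball (0 : EuclideanSpace ℝ (Fin n)) 1)).toReal

lemma cv_pos (n : ℕ) : 0 < cv n :=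
  ENNReal.toReal_pos (Metric.measure_ball_pos _ _ one_pos).ne' measure_ball_lt_top.ne

lemma vol_ball (n : ℕ) {R : ℝ} (hR : 0 < R) :
    (volume (Metric.ball (0 : EuclideanSpace ℝ (Fin n)) R)).toReal = R ^ n * cv n := by
  rw [Measure.addHaar_ball_of_pos _ _ hR, ENNReal.toReal_mul, ENNReal.toReal_ofReal (by positivity)]
  simp [cv]

/-- the unit ball in coordinates -/
def ub (n : ℕ) : Set (Fin n → ℝ) := {x | ∑ i, (x i)^2 < 1}

lemma ub_eq (n : ℕ) : ub n = (WithLp.linearEquiv 2 ℝ (Fin n → ℝ)).symm.toLinearMap ⁻¹'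
    (Metric.ball (0 : EuclideanSpace ℝ (Fin n)) 1) := by
  ext x
  simp only [ub, Set.mem_ofPred_eq, Set.mem_preimage, Metric.mem_ball, dist_zero_right,
    EuclideanSpace.norm_eq]
  rw [Real.sqrt_lt' one_pos]
  simp

lemma ub_convex (n : ℕ) : Convex ℝ (ub n) := by
  rw [ub_eq]
  exact (convex_ball _ _).linear_preimage _

lemma ub_open (n : ℕ) : IsOpen (ub n) := by
  refine isOpen_lt ?_ continuous_const
  fun_prop

lemma ub_vol (n : ℕ) : volume.real (ub n) = cv n := by
  rw [cv, Measure.real, ub_eq]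
  congr 1
  exact (PiLp.volume_preserving_toLp (Fin n)).measure_preimage
    measurableSet_ball.nullMeasurableSet

lemma ub_bdd (n : ℕ) : Bornology.IsBounded (ub n) := by
  refine (Metric.isBounded_iff_subset_closedBall 0).2 ⟨1, fun x hx => ?_⟩
  rw [mem_closedBall_zero_iff, pi_norm_le_iff_of_nonneg zero_le_one]
  intro i
  have h : (x i)^2 ≤ ∑ i, (x i)^2 :=
    Finset.single_le_sum (f := fun i => (x i)^2) (fun _ _ => sq_nonneg _) (Finset.mem_univ i)
  have : (x i)^2 < 1 ^ 2 := by
    have : ∑ i, (x i)^2 < 1 := hx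
    linarith
  exact (abs_lt_of_sq_lt_sq this zero_le_one).le

lemma smul_ub {n : ℕ} {r : ℝ} (hr : 0 < r) (x : Fin n → ℝ) :
    x ∈ r • ub n ↔ ∑ i, (x i)^2 < r ^ 2 := by
  rw [Set.mem_smul_set_iff_inv_smul_mem₀ hr.ne']
  simp only [ub, Set.mem_ofPred_eq, Pi.smul_apply, smul_eq_mul, mul_pow, ← Finset.mul_sum]
  rw [inv_pow, inv_mul_lt_iff₀ (by positivity), mul_one]

lemma base (n : ℕ) : Tendsto (fun R : ℝ => ((lb n R).ncard : ℝ) / R ^ n) atTop (𝓝 (cv n)) := by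
  have h := tendsto_card_div_pow_atTop_volume' (ub n) (ub_bdd n) (ub_open n).measurableSet
    ((ub_convex n).addHaar_frontier _) (by
      intro x y hx hxy z hz
      rw [smul_ub hx] at hz
      rw [smul_ub (hx.trans_le hxy)]
      exact hz.trans_le (by gcongr))
  rw [ub_vol] at h
  refine h.congr' ?_
  filter_upwards [eventually_gt_atTop 0] with R hR
  rw [Fintype.card_fin]
  congr 2
  rw [Nat.card_coe_set_eq]
  have hinj : Function.Injective (fun x : Fin n → ℤ => R⁻¹ • (fun i => (x i : ℝ))) := by
    intro x y hxy
    have := smul_right_injective _ (inv_ne_zero hR.ne') hxy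
    ext i
    exact_mod_cast congrFun this i
  rw [← Set.ncard_image_of_injective _ hinj]
  congr 1
  ext z
  rw [Set.mem_inter_iff, Set.mem_smul_set_iff_inv_smul_mem₀ (inv_ne_zero hR.ne'), inv_inv,
    SetLike.mem_coe, Module.Basis.mem_span_iff_repr_mem]
  have hz : z ∈ ub n ↔ ∑ i, ((R • z) i)^2 < R ^ 2 := by
    rw [← smul_ub hR, Set.smul_mem_smul_set_iff₀ hR.ne']
  rw [hz]
  constructor
  · rintro ⟨h1, h2⟩
    choose y hy using h2
    have hy' : (fun i => (y i : ℝ)) = R • z := by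
      ext i
      simpa using hy i
    refine ⟨y, ?_, ?_⟩
    · change ∑ i, ((fun i => (y i : ℝ)) i)^2 < R ^ 2
      rw [hy']; exact h1
    · simp only [hy']
      rw [inv_smul_smul₀ hR.ne']
  · rintro ⟨y, h1, rfl⟩
    simp only [smul_inv_smul₀ hR.ne']
    exact ⟨h1, fun i => ⟨y i, by simp⟩⟩

lemma dv_tendsto (n : ℕ) {d : ℕ} (hd : 0 < d) :
    Tendsto (fun R : ℝ => ({x : Fin n → ℤ | dv d x ∧ x ∈ lb n R}.ncard : ℝ) / R ^ n) atTop
      (𝓝 (cv n / d ^ n)) := by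
  have hd' : (0 : ℝ) < d := by exact_mod_cast hd
  have h := ((base n).comp (tendsto_id.atTop_div_const hd')).div_const ((d : ℝ) ^ n)
  refine h.congr' ?_
  filter_upwards [eventually_gt_atTop 0] with R hR
  rw [dv_ncard hd]
  simp only [Function.comp, id, div_pow]
  field_simp

lemma fin_tendsto (n : ℕ) (S : Finset ℕ) (hS : ∀ b ∈ S, 0 < b)
    (hcop : ∀ a ∈ S, ∀ b ∈ S, a ≠ b → Nat.Coprime a b) :
    ∀ d : ℕ, 0 < d → (∀ b ∈ S, Nat.Coprime d b) →
    Tendsto (fun R : ℝ =>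
      ({x : Fin n → ℤ | (dv d x ∧ ∀ b ∈ S, ¬ dv b x) ∧ x ∈ lb n R}.ncard : ℝ) / R ^ n) atTop
      (𝓝 (cv n / d ^ n * ∏ b ∈ S, (1 - 1 / (b : ℝ) ^ n))) := by
  induction S using Finset.induction_on with
  | empty =>
    intro d hd _
    simpa using dv_tendsto n hd
  | insert a S ha ih =>
    intro d hd hdS
    have ih' := ih (fun b hb => hS b (Finset.mem_insert_of_mem hb))
      (fun a ha b hb => hcop a (Finset.mem_insert_of_mem ha) b (Finset.mem_insert_of_mem hb))
    have ha0 : 0 < a := hS a (Finset.mem_insert_self _ _)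
    have hda : Nat.Coprime d a := hdS a (Finset.mem_insert_self _ _)
    have h1 := ih' d hd (fun b hb => hdS b (Finset.mem_insert_of_mem hb))
    have h2 := ih' (d * a) (by positivity) (fun b hb => Nat.Coprime.mul_left
      (hdS b (Finset.mem_insert_of_mem hb))
      (hcop a (Finset.mem_insert_self _ _) b (Finset.mem_insert_of_mem hb)
        (by rintro rfl; exact ha hb)))
    have h3 := h1.sub h2
    rw [Finset.prod_insert ha]
    have ha0' : (0 : ℝ) < a := by exact_mod_cast ha0
    have hd0' : (0 : ℝ) < d := by exact_mod_cast hd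
    convert h3.congr' ?_ using 2
    · push_cast
      rw [mul_pow]
      field_simp
    · filter_upwards [eventually_gt_atTop 0] with R hR
      rw [← sub_div]
      congr 1
      rw [sub_eq_iff_eq_add]
      norm_cast
      rw [← Set.ncard_union_eq ?_ ((lb_finite n hR).subset fun x hx => hx.2)
        ((lb_finite n hR).subset fun x hx => hx.2)]
      · congr 1
        ext x
        simp only [Set.mem_ofPred_eq, Set.mem_union, Finset.mem_insert, forall_eq_or_imp,
          dv_mul hda]
        tauto
      · rw [Set.disjoint_left]
        intro x hx hx'
        simp only [Set.mem_ofPred_eq, Finset.mem_insert, forall_eq_or_imp, dv_mul hda] at hx hx'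
        tauto

lemma one_dv {n : ℕ} (x : Fin n → ℤ) : dv 1 x := ⟨x, by simp⟩

lemma nz_card (n : ℕ) {b : ℕ} (hb : 0 < b) {R : ℝ} (hR : 0 < R) :
    ({x : Fin n → ℤ | (dv b x ∧ x ≠ 0) ∧ x ∈ lb n R}.ncard : ℝ) ≤ (3 * R) ^ n * (1 / (b : ℝ) ^ n) := by
  have hb' : (0 : ℝ) < b := by exact_mod_cast hb
  by_cases h : (b : ℝ) ≤ R
  · have h1 : {x : Fin n → ℤ | (dv b x ∧ x ≠ 0) ∧ x ∈ lb n R}.ncard ≤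
        {x : Fin n → ℤ | dv b x ∧ x ∈ lb n R}.ncard :=
      Set.ncard_le_ncard (fun x hx => ⟨hx.1.1, hx.2⟩) ((lb_finite n hR).subset fun x hx => hx.2)
    rw [dv_ncard hb] at h1
    have h2 := lb_ncard_le n ((one_le_div hb').2 h)
    calc _ ≤ ((lb n (R / b)).ncard : ℝ) := by exact_mod_cast h1
      _ ≤ _ := h2
      _ = _ := by rw [← mul_div_assoc, div_pow]; ring
  · have : {x : Fin n → ℤ | (dv b x ∧ x ≠ 0) ∧ x ∈ lb n R} = ∅ := by
      ext x
      simp only [Set.mem_ofPred_eq, Set.mem_empty_iff_false, iff_false]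
      rintro ⟨⟨h1, h2⟩, h3⟩
      exact h (dv_ne_zero hb hR h3 h1 h2)
    rw [this]
    simp only [Set.ncard_empty, Nat.cast_zero]
    positivity

lemma tail (n : ℕ) (B : Set ℕ) (hB : ∀ b ∈ B, 0 < b)
    (hsum : Summable fun b : B => 1 / ((b : ℕ) : ℝ)^n) (S : Finset B) {R : ℝ} (hR : 0 < R) :
    ({x : Fin n → ℤ | (∀ b ∈ S, ¬ dv (b : ℕ) x) ∧ x ∈ lb n R}.ncard : ℝ) ≤
      {x : Fin n → ℤ | (∀ b ∈ B, ¬ dv b x) ∧ x ∈ lb n R}.ncard +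
      (1 + (3 * R) ^ n * ∑' b : {b : B // b ∉ S}, 1 / ((b : ℕ) : ℝ)^n) := by
  classical
  have hfin : {b : {b : B // b ∉ S} | ((b : ℕ) : ℝ) ≤ R}.Finite := by
    have : (Set.Iic ⌊R⌋₊).Finite := Set.finite_Iic _
    refine (this.preimage (f := fun b : {b : B // b ∉ S} => (b : ℕ)) ?_).subset ?_
    · intro a _ b _ h
      exact Subtype.ext (Subtype.ext h)
    · intro b hb
      exact Nat.le_floor hb
  set T := hfin.toFinset with hT
  have hsub : {x : Fin n → ℤ | (∀ b ∈ S, ¬ dv (b : ℕ) x) ∧ x ∈ lb n R} ⊆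
      {x : Fin n → ℤ | (∀ b ∈ B, ¬ dv b x) ∧ x ∈ lb n R} ∪ ({0} ∪
        ⋃ b ∈ T, {x : Fin n → ℤ | (dv (b : ℕ) x ∧ x ≠ 0) ∧ x ∈ lb n R}) := by
    rintro x ⟨h1, h2⟩
    by_cases h0 : x = 0
    · right; left; exact h0
    by_cases hx : ∀ b ∈ B, ¬ dv b x
    · left; exact ⟨hx, h2⟩
    right; right
    push Not at hx
    obtain ⟨b, hbB, hb⟩ := hx
    have hbS : (⟨b, hbB⟩ : B) ∉ S := fun h => h1 _ h hb
    simp only [Set.mem_iUnion]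
    refine ⟨⟨⟨b, hbB⟩, hbS⟩, ?_, ⟨hb, h0⟩, h2⟩
    rw [hT, Set.Finite.mem_toFinset]
    exact dv_ne_zero (hB b hbB) hR h2 hb h0
  have hf1 : ({x : Fin n → ℤ | (∀ b ∈ B, ¬ dv b x) ∧ x ∈ lb n R}).Finite :=
    (lb_finite n hR).subset fun x hx => hx.2
  have hf2 : (⋃ b ∈ T, {x : Fin n → ℤ | (dv (b : ℕ) x ∧ x ≠ 0) ∧ x ∈ lb n R}).Finite :=
    (lb_finite n hR).subset (Set.iUnion₂_subset fun b _ x hx => hx.2)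
  have e1 := Set.ncard_le_ncard hsub (hf1.union ((Set.finite_singleton 0).union hf2))
  have e2 := e1.trans (Set.ncard_union_le _ _)
  have e3 := e2.trans (Nat.add_le_add_left (Set.ncard_union_le _ _) _)
  rw [Set.ncard_singleton] at e3
  have e4 : (⋃ b ∈ T, {x : Fin n → ℤ | (dv (b : ℕ) x ∧ x ≠ 0) ∧ x ∈ lb n R}).ncard ≤
      ∑ b ∈ T, {x : Fin n → ℤ | (dv (b : ℕ) x ∧ x ≠ 0) ∧ x ∈ lb n R}.ncard :=
    Finset.set_ncard_biUnion_le _ _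
  have e5 : ((⋃ b ∈ T, {x : Fin n → ℤ | (dv (b : ℕ) x ∧ x ≠ 0) ∧ x ∈ lb n R}).ncard : ℝ) ≤
      (3 * R) ^ n * ∑' b : {b : B // b ∉ S}, 1 / ((b : ℕ) : ℝ)^n := by
    calc _ ≤ ∑ b ∈ T, ({x : Fin n → ℤ | (dv (b : ℕ) x ∧ x ≠ 0) ∧ x ∈ lb n R}.ncard : ℝ) := by
          exact_mod_cast e4
      _ ≤ ∑ b ∈ T, (3 * R) ^ n * (1 / ((b : ℕ) : ℝ) ^ n) :=
          Finset.sum_le_sum fun b _ => nz_card n (hB _ b.1.2) hR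
      _ = (3 * R) ^ n * ∑ b ∈ T, (1 / ((b : ℕ) : ℝ) ^ n) := by rw [Finset.mul_sum]
      _ ≤ _ := by
        gcongr
        exact (hsum.comp_injective Subtype.val_injective).sum_le_tsum _
          (fun b _ => by positivity)
  have e6 : ({x : Fin n → ℤ | (∀ b ∈ S, ¬ dv (b : ℕ) x) ∧ x ∈ lb n R}.ncard : ℝ) ≤
      {x : Fin n → ℤ | (∀ b ∈ B, ¬ dv b x) ∧ x ∈ lb n R}.ncard + (1 +
      (⋃ b ∈ T, {x : Fin n → ℤ | (dv (b : ℕ) x ∧ x ≠ 0) ∧ x ∈ lb n R}).ncard) := by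
    exact_mod_cast e3
  linarith

lemma S_tendsto (n : ℕ) (B : Set ℕ) (hB : ∀ b ∈ B, 0 < b)
    (hcop : ∀ a ∈ B, ∀ b ∈ B, a ≠ b → Nat.Coprime a b) (S : Finset B) :
    Tendsto (fun R : ℝ =>
      ({x : Fin n → ℤ | (∀ b ∈ S, ¬ dv (b : ℕ) x) ∧ x ∈ lb n R}.ncard : ℝ) / R ^ n) atTop
      (𝓝 (cv n * ∏ b ∈ S, (1 - 1 / ((b : ℕ) : ℝ) ^ n))) := by
  have h := fin_tendsto n (S.map (Function.Embedding.subtype _))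
    (by simp only [Finset.mem_map]; rintro _ ⟨b, _, rfl⟩; exact hB _ b.2)
    (by
      simp only [Finset.mem_map]
      rintro _ ⟨a, _, rfl⟩ _ ⟨b, _, rfl⟩
      exact hcop _ a.2 _ b.2) 1 one_pos (fun _ _ => Nat.coprime_one_left _)
  simpa [one_dv] using h

theorem main (n : ℕ) (hn : 1 ≤ n) (B : Set ℕ) (hB : ∀ b ∈ B, 0 < b)
    (hcop : ∀ a ∈ B, ∀ b ∈ B, a ≠ b → Nat.Coprime a b)
    (hsum : Summable fun b : B => 1 / ((b : ℕ) : ℝ)^n) :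
    Tendsto (fun R : ℝ => ({x : Fin n → ℤ | (∀ b ∈ B, ¬ dv b x) ∧ x ∈ lb n R}.ncard : ℝ) / R ^ n)
      atTop (𝓝 (cv n * ∏' b : B, (1 - 1 / ((b : ℕ) : ℝ)^n))) := by
  have hmul : Multipliable fun b : B => (1 - 1 / ((b : ℕ) : ℝ)^n) := by
    simpa [sub_eq_add_neg] using Real.multipliable_one_add_of_summable hsum.neg
  have hP := hmul.hasProd.const_mul (cv n)
  have hQ := (tendsto_tsum_compl_atTop_zero fun b : B => 1 / ((b : ℕ) : ℝ)^n).const_mul (3 ^ n : ℝ)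
  rw [mul_zero] at hQ
  rw [Metric.tendsto_nhds]
  intro ε hε
  obtain ⟨S, hS1, hS2⟩ := ((Metric.tendsto_nhds.1 hP (ε / 4) (by positivity)).and
    (Metric.tendsto_nhds.1 hQ (ε / 4) (by positivity))).exists
  have hinv : Tendsto (fun R : ℝ => (1 : ℝ) / R ^ n) atTop (𝓝 0) :=
    (tendsto_pow_atTop (by omega)).const_div_atTop 1
  filter_upwards [eventually_gt_atTop 0,
    Metric.tendsto_nhds.1 (S_tendsto n B hB hcop S) (ε / 4) (by positivity),
    Metric.tendsto_nhds.1 hinv (ε / 4) (by positivity)] with R hR h1 h2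
  have hRn : 0 < R ^ n := by positivity
  have h3 := (div_le_div_iff_of_pos_right hRn).2 (tail n B hB hsum S hR)
  have h4 : (({x : Fin n → ℤ | (∀ b ∈ B, ¬ dv b x) ∧ x ∈ lb n R}.ncard : ℝ)) / R ^ n ≤
      ({x : Fin n → ℤ | (∀ b ∈ S, ¬ dv (b : ℕ) x) ∧ x ∈ lb n R}.ncard : ℝ) / R ^ n := by
    refine (div_le_div_iff_of_pos_right hRn).2 (Nat.cast_le.2 (Set.ncard_le_ncard ?_
      ((lb_finite n hR).subset fun x hx => hx.2)))
    intro x hx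
    exact ⟨fun b _ => hx.1 b b.2, hx.2⟩
  rw [add_div, add_div, mul_pow, mul_right_comm, mul_div_cancel_right₀ _ hRn.ne'] at h3
  simp only [Real.dist_eq, sub_zero] at *
  rw [abs_lt] at *
  constructor <;> linarith [h1.1, h1.2, h2.1, h2.2, hS1.1, hS1.2, hS2.1, hS2.2]

end BFree
theorem Bfree_density (n : ℕ) (hn : 1 ≤ n) (B : Set ℕ) (hB2 : ∀ b ∈ B, 2 ≤ b)
    (hcop : ∀ a ∈ B, ∀ b ∈ B, a ≠ b → Nat.Coprime a b)
    (hsum : Summable fun b : B => 1 / ((b : ℕ) : ℝ)^n) :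
    Tendsto (fun R : ℝ =>
      (Nat.card {x : Fin n → ℤ //
        (∀ b ∈ B, ¬ ∃ y : Fin n → ℤ, x = (b : ℤ) • y) ∧ ∑ i, ((x i : ℝ))^2 < R^2} : ℝ) /
        (MeasureTheory.volume (Metric.ball (0 : EuclideanSpace ℝ (Fin n)) R)).toReal)
      atTop (𝓝 (∏' b : B, (1 - 1 / ((b : ℕ) : ℝ)^n))) := by
  have h := BFree.main n hn B (fun b hb => by have := hB2 b hb; omega) hcop hsum
  have hc := BFree.cv_pos n
  have h2 := h.div_const (BFree.cv n)
  rw [mul_div_cancel_left₀ _ hc.ne'] at h2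
  refine h2.congr' ?_
  filter_upwards [eventually_gt_atTop 0] with R hR
  rw [BFree.vol_ball n hR, div_div]
  rfl
end

section
/- Let K = ℚ(√2) with ring of integers O_K = ℤ[√2], let σ be the nontrivial field automorphism of K (determined by √2 ↦ −√2), and let j : K → ℝ² be the Minkowski embedding x ↦ (x, σ(x)). For k ≥ 2, let V = O_K \ ⋃_𝔭 𝔭^k be the set of k-free integers of K, the union running over all nonzero prime ideals 𝔭 of O_K. Then the natural density of j(V) in ℝ² exists and equals lim_{R→∞} |j(V) ∩ B_R(0)| / (π R²) = (1/(2√2)) · ∏_𝔭 (1 − N(𝔭)^{−k}), where the product runs over all nonzero prime ideals 𝔭 of O_K and N(𝔭) denotes the absolute norm (the index of 𝔭 in O_K); equivalently the density is (1/(2√2)) · 1/ζ_K(k), with ζ_K the Dedekind zeta function of K. -/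
open Filter Topology

/-- The `k`-free integers of `K = ℚ(√2)`, i.e. the elements of `O_K = ℤ[√2]` lying in no
`k`-th power of a nonzero prime ideal. -/
def kfreeZsqrt2 (k : ℕ) : Set (ℤ√2) :=
  {a | ∀ 𝔭 : Ideal (ℤ√2), 𝔭.IsPrime → 𝔭 ≠ ⊥ → a ∉ 𝔭 ^ k}

/-- The Minkowski embedding `j : ℤ[√2] → ℝ²`, `x ↦ (x, σ(x))` with `σ(√2) = −√2`. -/
noncomputable def mink (a : ℤ√2) : ℝ × ℝ :=
  ((a.re : ℝ) + (a.im : ℝ) * Real.sqrt 2, (a.re : ℝ) - (a.im : ℝ) * Real.sqrt 2)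

theorem zs_norm_eq_zero (a : ℤ√2) : a.norm = 0 ↔ a = 0 := by
  apply Zsqrtd.norm_eq_zero
  intro n hn
  have h1 : n < 2 := by nlinarith
  have h2 : -2 < n := by nlinarith
  interval_cases n <;> omega

noncomputable def zsDiv (x y : ℤ√2) : ℤ√2 :=
  ⟨round (((x * star y).re : ℚ) / (y.norm : ℚ)), round (((x * star y).im : ℚ) / (y.norm : ℚ))⟩

theorem zs_mod_lt (x y : ℤ√2) (hy : y ≠ 0) :
    (x - y * zsDiv x y).norm.natAbs < y.norm.natAbs := by
  have hN : y.norm ≠ 0 := fun h => hy ((zs_norm_eq_zero y).1 h)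
  have hNq : (y.norm : ℚ) ≠ 0 := by exact_mod_cast hN
  have key : ((x - y * zsDiv x y).norm : ℚ) = y.norm *
      ((((x * star y).re : ℚ) / (y.norm : ℚ) - round (((x * star y).re : ℚ) / (y.norm : ℚ)))^2
        - 2 * (((x * star y).im : ℚ) / (y.norm : ℚ)
          - round (((x * star y).im : ℚ) / (y.norm : ℚ)))^2) := by
    have e : ((x - y * zsDiv x y).norm * y.norm : ℚ) =
        (((x * star y).re : ℚ) - y.norm * (zsDiv x y).re)^2
        - 2 * (((x * star y).im : ℚ) - y.norm * (zsDiv x y).im)^2 := by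
      simp only [Zsqrtd.norm_def, Zsqrtd.re_sub, Zsqrtd.im_sub, Zsqrtd.re_mul, Zsqrtd.im_mul,
        Zsqrtd.re_star, Zsqrtd.im_star]
      push_cast
      ring
    apply mul_right_cancel₀ hNq
    rw [e]
    simp only [zsDiv]
    field_simp
  set α := ((x * star y).re : ℚ) / (y.norm : ℚ) - round (((x * star y).re : ℚ) / (y.norm : ℚ))
    with hα
  set β := ((x * star y).im : ℚ) / (y.norm : ℚ) - round (((x * star y).im : ℚ) / (y.norm : ℚ))
    with hβ
  have ha : |α| ≤ 1/2 := abs_sub_round _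
  have hb : |β| ≤ 1/2 := abs_sub_round _
  have ha2 : α^2 ≤ 1/4 := by
    have := sq_le_sq' (by linarith [abs_nonneg α]) ha
    rw [sq_abs] at this; linarith
  have hb2 : β^2 ≤ 1/4 := by
    have := sq_le_sq' (by linarith [abs_nonneg β]) hb
    rw [sq_abs] at this; linarith
  have hlt : |α^2 - 2 * β^2| < 1 := by
    rw [abs_lt]; constructor <;> nlinarith [sq_nonneg α, sq_nonneg β]
  have : |((x - y * zsDiv x y).norm : ℚ)| < |(y.norm : ℚ)| := by
    rw [key, abs_mul]
    exact mul_lt_of_lt_one_right (abs_pos.2 hNq) hlt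
  have h2 : |(x - y * zsDiv x y).norm| < |y.norm| := by exact_mod_cast this
  rw [Int.abs_eq_natAbs, Int.abs_eq_natAbs] at h2
  exact_mod_cast h2

@[reducible] noncomputable def zsED : EuclideanDomain (ℤ√2) :=
  { (inferInstance : CommRing (ℤ√2)), (inferInstance : Nontrivial (ℤ√2)) with
    quotient := zsDiv
    remainder := fun x y => x - y * zsDiv x y
    quotient_zero := by
      intro a
      simp [zsDiv]
      rfl
    quotient_mul_add_remainder_eq := fun x y => by ring
    r := fun a b => a.norm.natAbs < b.norm.natAbs
    r_wellFounded := (measure (fun a : ℤ√2 => a.norm.natAbs)).wf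
    remainder_lt := fun x y hy => zs_mod_lt x y hy
    mul_left_not_lt := fun a b hb => by
      have : b.norm ≠ 0 := fun h => hb ((zs_norm_eq_zero b).1 h)
      have hb' : 1 ≤ b.norm.natAbs := by omega
      rw [not_lt, Zsqrtd.norm_mul, Int.natAbs_mul]
      exact Nat.le_mul_of_pos_right _ hb' }

theorem zs_isDomain : IsDomain (ℤ√2) := @EuclideanDomain.instIsDomain _ zsED

instance zsDomain : IsDomain (ℤ√2) := zs_isDomain

instance zsPID : IsPrincipalIdealRing (ℤ√2) :=
  @EuclideanDomain.to_principal_ideal_domain _ zsED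

instance zsDedekind : IsDedekindDomain (ℤ√2) := IsPrincipalIdealRing.isDedekindDomain _

noncomputable def zsBasis : Module.Basis (Fin 2) ℤ (ℤ√2) :=
  Module.Basis.ofEquivFun
    { toFun := fun a => ![a.re, a.im]
      invFun := fun v => ⟨v 0, v 1⟩
      map_add' := fun a b => by ext i; fin_cases i <;> simp
      map_smul' := fun c a => by ext i; fin_cases i <;> simp
      left_inv := fun a => by ext <;> simp
      right_inv := fun v => by ext i; fin_cases i <;> simp }

instance zsFree : Module.Free ℤ (ℤ√2) := Module.Free.of_basis zsBasis
instance zsFinite : Module.Finite ℤ (ℤ√2) := Module.Finite.of_basis zsBasis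

theorem zs_algNorm (a : ℤ√2) : Algebra.norm ℤ a = a.norm := by
  rw [Algebra.norm_eq_matrix_det zsBasis, Matrix.det_fin_two]
  simp [Algebra.leftMulMatrix_apply, LinearMap.toMatrix_apply, zsBasis, Zsqrtd.norm_def,
    Module.Basis.coe_ofEquivFun]

/-- index of an ideal -/
theorem zs_index_le (I : Ideal (ℤ√2)) {a : ℤ√2} (ha : a ∈ I) (h0 : a ≠ 0) :
    (Nat.card ((ℤ√2) ⧸ I) : ℝ) ≤ |(a.norm : ℝ)| := by
  have h1 := Ideal.absNorm_dvd_absNorm_of_le ((Ideal.span_singleton_le_iff_mem I).2 ha)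
  rw [Ideal.absNorm_span_singleton, zs_algNorm] at h1
  have hN : a.norm ≠ 0 := fun h => h0 ((zs_norm_eq_zero a).1 h)
  have h2 := Nat.le_of_dvd (by omega) h1
  rw [Ideal.absNorm_apply, Submodule.cardQuot_apply] at h2
  have h3 : (Nat.card ((ℤ√2) ⧸ I) : ℝ) ≤ (a.norm.natAbs : ℝ) := by exact_mod_cast h2
  rwa [Nat.cast_natAbs, Int.cast_abs] at h3

theorem zs_card_pow (I : Ideal (ℤ√2)) (k : ℕ) :
    Nat.card ((ℤ√2) ⧸ (I ^ k)) = Nat.card ((ℤ√2) ⧸ I) ^ k := by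
  have := map_pow (Ideal.absNorm (S := ℤ√2)) I k
  simpa only [Ideal.absNorm_apply, Submodule.cardQuot_apply] using this

theorem zs_card_pos (I : Ideal (ℤ√2)) (hI : I ≠ ⊥) : 0 < Nat.card ((ℤ√2) ⧸ I) := by
  have := (Ideal.absNorm_eq_zero_iff (I := I)).not.2 hI
  rw [Ideal.absNorm_apply, Submodule.cardQuot_apply] at this
  omega

abbrev ZsP := {I : Ideal (ℤ√2) // I.IsPrime ∧ I ≠ ⊥}

theorem zsP_maximal (p : ZsP) : p.1.IsMaximal :=
  Ring.DimensionLEOne.maximalOfPrime p.2.2 p.2.1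

theorem zsP_coprime (k : ℕ) {p q : ZsP} (h : p ≠ q) : IsCoprime (p.1 ^ k) (q.1 ^ k) := by
  apply IsCoprime.pow
  rw [Ideal.isCoprime_iff_sup_eq]
  exact (zsP_maximal p).coprime_of_ne (zsP_maximal q) (fun e => h (Subtype.ext e))

theorem zsP_finite (p : ZsP) : Finite ((ℤ√2) ⧸ p.1) :=
  Nat.finite_of_card_ne_zero (zs_card_pos p.1 p.2.2).ne'

theorem zsP_char (p : ZsP) : (ringChar ((ℤ√2) ⧸ p.1)).Prime ∧
    ringChar ((ℤ√2) ⧸ p.1) ≤ Nat.card ((ℤ√2) ⧸ p.1) ∧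
    ((ringChar ((ℤ√2) ⧸ p.1) : ℕ) : ℤ√2) ∈ p.1 := by
  have := zsP_finite p
  have := p.2.1
  refine ⟨?_, ?_, ?_⟩
  · exact CharP.char_is_prime ((ℤ√2) ⧸ p.1) _
  · apply Nat.le_of_dvd (zs_card_pos p.1 p.2.2)
    apply ringChar.dvd
    have := Fintype.ofFinite ((ℤ√2) ⧸ p.1)
    rw [Nat.card_eq_fintype_card]
    exact Nat.cast_card_eq_zero _
  · rw [← Ideal.Quotient.eq_zero_iff_mem, map_natCast]
    exact CharP.cast_eq_zero _ _

theorem zsP_fiber (T : Finset ZsP) (q : ℕ) (hT : ∀ p ∈ T, ringChar ((ℤ√2) ⧸ p.1) = q) :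
    T.card ≤ 2 := by
  rcases T.eq_empty_or_nonempty with rfl | ⟨p0, hp0⟩
  · simp
  have hq : q.Prime := hT p0 hp0 ▸ (zsP_char p0).1
  have hsurj := Ideal.pi_quotient_surjective (I := fun p : T => p.1.1) (by
    intro p p' h
    have := zsP_coprime 1 (p := p.1) (q := p'.1) (fun e => h (Subtype.ext e))
    simpa using this)
  let J : Ideal (ℤ√2) := Ideal.span {(q : ℤ√2)}
  have hle : ∀ p : T, J ≤ p.1.1 := fun p => by
    rw [Ideal.span_singleton_le_iff_mem, ← hT p.1 p.2]
    exact (zsP_char p.1).2.2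
  have hJcard : Nat.card ((ℤ√2) ⧸ J) = q ^ 2 := by
    have h1 := Ideal.absNorm_span_singleton (S := ℤ√2) (q : ℤ√2)
    rw [zs_algNorm, Zsqrtd.norm_natCast, Ideal.absNorm_apply, Submodule.cardQuot_apply,
      Int.natAbs_mul, Int.natAbs_natCast] at h1
    rw [h1, sq]
  have hfin : Finite ((ℤ√2) ⧸ J) := Nat.finite_of_card_ne_zero (by
    rw [hJcard]; exact pow_ne_zero _ hq.ne_zero)
  have hcard := Nat.card_le_card_of_surjective
    (fun (x : (ℤ√2) ⧸ J) (p : T) => Ideal.Quotient.factor (hle p) x) (by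
      intro x
      obtain ⟨r, hr⟩ := hsurj x
      refine ⟨Ideal.Quotient.mk J r, ?_⟩
      funext p
      simpa using hr p)
  rw [Nat.card_pi, hJcard] at hcard
  have h2 : q ^ T.card ≤ q ^ 2 := by
    refine le_trans ?_ hcard
    rw [← Fintype.card_coe, ← Finset.card_univ]
    apply Finset.pow_card_le_prod
    intro p _
    have := (zsP_char p.1).2.1
    rwa [hT p.1 p.2] at this
  exact (Nat.pow_le_pow_iff_right hq.one_lt).1 h2

theorem zsP_summable (k : ℕ) (hk : 2 ≤ k) :
    Summable fun p : ZsP => 1 / (Nat.card ((ℤ√2) ⧸ p.1) : ℝ) ^ k := by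
  classical
  have hs : Summable fun n : ℕ => 2 * (1 / (n : ℝ) ^ 2) :=
    (Real.summable_one_div_nat_pow.2 (by norm_num)).mul_left 2
  apply summable_of_sum_le (c := ∑' n : ℕ, 2 * (1 / (n : ℝ) ^ 2))
  · intro p; positivity
  intro U
  calc ∑ p ∈ U, 1 / (Nat.card ((ℤ√2) ⧸ p.1) : ℝ) ^ k
      ≤ ∑ p ∈ U, 1 / ((ringChar ((ℤ√2) ⧸ p.1) : ℕ) : ℝ) ^ 2 := by
        apply Finset.sum_le_sum
        intro p _
        obtain ⟨h1, h2, -⟩ := zsP_char p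
        have h3 : 0 < ((ringChar ((ℤ√2) ⧸ p.1) : ℕ) : ℝ) := by exact_mod_cast h1.pos
        apply one_div_le_one_div_of_le (by positivity)
        have : (ringChar ((ℤ√2) ⧸ p.1)) ^ 2 ≤ Nat.card ((ℤ√2) ⧸ p.1) ^ k :=
          (Nat.pow_le_pow_left h2 2).trans (Nat.pow_le_pow_right (zs_card_pos p.1 p.2.2) hk)
        exact_mod_cast this
    _ = ∑ n ∈ U.image (fun p : ZsP => ringChar ((ℤ√2) ⧸ p.1)),
          (U.filter (fun p : ZsP => ringChar ((ℤ√2) ⧸ p.1) = n)).card • (1 / (n : ℝ) ^ 2) :=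
        Finset.sum_comp (fun n : ℕ => 1 / (n : ℝ) ^ 2)
          (fun p : ZsP => ringChar ((ℤ√2) ⧸ p.1))
    _ ≤ ∑ n ∈ U.image (fun p : ZsP => ringChar ((ℤ√2) ⧸ p.1)), 2 * (1 / (n : ℝ) ^ 2) := by
        apply Finset.sum_le_sum
        intro n _
        rw [nsmul_eq_mul]
        apply mul_le_mul_of_nonneg_right _ (by positivity)
        exact_mod_cast zsP_fiber _ n (fun p hp => (Finset.mem_filter.1 hp).2)
    _ ≤ _ := hs.sum_le_tsum _ (fun n _ => by positivity)

/-- ball -/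
def zsBall (R : ℝ) : Set (ℤ√2) := {a | (mink a).1 ^ 2 + (mink a).2 ^ 2 < R ^ 2}

theorem mink_sq (a : ℤ√2) :
    (mink a).1 ^ 2 + (mink a).2 ^ 2 = 2 * (a.re : ℝ) ^ 2 + 4 * (a.im : ℝ) ^ 2 := by
  have : Real.sqrt 2 ^ 2 = 2 := Real.sq_sqrt (by norm_num)
  simp only [mink]
  ring_nf
  rw [this]; ring

theorem mink_mul (a : ℤ√2) : (mink a).1 * (mink a).2 = (a.norm : ℝ) := by
  have : Real.sqrt 2 ^ 2 = 2 := Real.sq_sqrt (by norm_num)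
  simp only [mink, Zsqrtd.norm_def]
  push_cast
  ring_nf
  rw [this]

theorem mink_sub (a b : ℤ√2) : mink (a - b) = mink a - mink b := by
  ext <;> simp [mink] <;> ring

theorem zsBall_finite (R : ℝ) : (zsBall R).Finite := by
  have : (zsBall R) ⊆ (fun v : ℤ × ℤ => (⟨v.1, v.2⟩ : ℤ√2)) ''
      (Set.Icc (-⌈|R|⌉) ⌈|R|⌉ ×ˢ Set.Icc (-⌈|R|⌉) ⌈|R|⌉) := by
    intro a ha
    have h : 2 * (a.re : ℝ) ^ 2 + 4 * (a.im : ℝ) ^ 2 < R ^ 2 := by rw [← mink_sq]; exact ha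
    have h1 : |(a.re : ℝ)| ≤ |R| := sq_le_sq.1 (by nlinarith)
    have h2 : |(a.im : ℝ)| ≤ |R| := sq_le_sq.1 (by nlinarith)
    have hR := Int.le_ceil |R|
    have h3 : |a.re| ≤ ⌈|R|⌉ := by exact_mod_cast h1.trans hR
    have h4 : |a.im| ≤ ⌈|R|⌉ := by exact_mod_cast h2.trans hR
    refine ⟨(a.re, a.im), ⟨?_, ?_⟩, rfl⟩
    · exact abs_le.1 h3
    · exact abs_le.1 h4
  exact (((Set.finite_Icc _ _).prod (Set.finite_Icc _ _)).image _).subset this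

theorem zs_ideal_count (I : Ideal (ℤ√2)) (hI : I ≠ ⊥) (R : ℝ) (hR : 0 < R) :
    ({a | a ∈ I ∧ a ≠ 0 ∧ a ∈ zsBall R}.ncard : ℝ) ≤
      16 * R ^ 2 * (1 / (Nat.card ((ℤ√2) ⧸ I) : ℝ)) := by
  have hNpos : (0 : ℝ) < Nat.card ((ℤ√2) ⧸ I) := by exact_mod_cast zs_card_pos I hI
  rcases Set.eq_empty_or_nonempty {a | a ∈ I ∧ a ≠ 0 ∧ a ∈ zsBall R} with h | ⟨a0, ha0, h0, hb0⟩
  · rw [h]; simp only [Set.ncard_empty, Nat.cast_zero]; positivity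
  set N : ℝ := ((Nat.card ((ℤ√2) ⧸ I) : ℕ) : ℝ) with hN
  set s := Real.sqrt N with hs
  have hspos : 0 < s := Real.sqrt_pos.2 hNpos
  have hs2 : s ^ 2 = N := Real.sq_sqrt hNpos.le
  have hsR : s ≤ R := by
    have h1 := zs_index_le I ha0 h0
    rw [← mink_mul, abs_mul] at h1
    have h2 : (mink a0).1 ^ 2 + (mink a0).2 ^ 2 < R ^ 2 := hb0
    rw [← sq_abs (mink a0).1, ← sq_abs (mink a0).2] at h2
    apply le_of_sq_le_sq _ hR.le
    nlinarith [sq_nonneg (|(mink a0).1| - |(mink a0).2|), abs_nonneg (mink a0).1, abs_nonneg (mink a0).2]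
  let M := ⌊R / s⌋
  have hM1 : (M : ℝ) ≤ R / s := Int.floor_le _
  have hM2 : R / s < M + 1 := Int.lt_floor_add_one _
  have hRs : 1 ≤ R / s := (one_le_div hspos).2 hsR
  have hM0 : 1 ≤ M := Int.le_floor.2 (by simpa using hRs)
  let f : ℤ√2 → ℤ × ℤ := fun a => (⌊(mink a).1 / s⌋, ⌊(mink a).2 / s⌋)
  have hcoord : ∀ x : ℝ, x ^ 2 < R ^ 2 → ⌊x / s⌋ ∈ Finset.Icc (-M - 1) M := by
    intro x hx
    have := abs_lt_of_sq_lt_sq hx hR.le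
    obtain ⟨h1, h2⟩ := abs_lt.1 this
    rw [Finset.mem_Icc]
    constructor
    · apply Int.le_floor.2
      push_cast
      have : -(R / s) ≤ x / s := by rw [← neg_div]; gcongr
      linarith
    · exact Int.floor_le_floor (by gcongr)
  have hmaps : ∀ a ∈ {a | a ∈ I ∧ a ≠ 0 ∧ a ∈ zsBall R},
      f a ∈ ((Finset.Icc (-M - 1) M ×ˢ Finset.Icc (-M - 1) M : Finset (ℤ × ℤ)) : Set (ℤ × ℤ)) := by
    rintro a ⟨-, -, hb⟩
    have h2 : (mink a).1 ^ 2 + (mink a).2 ^ 2 < R ^ 2 := hb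
    rw [Finset.mem_coe, Finset.mem_product]
    exact ⟨hcoord _ (by nlinarith [sq_nonneg (mink a).2]),
      hcoord _ (by nlinarith [sq_nonneg (mink a).1])⟩
  have hinj : Set.InjOn f {a | a ∈ I ∧ a ≠ 0 ∧ a ∈ zsBall R} := by
    rintro a ⟨ha, -, -⟩ b ⟨hb, -, -⟩ hab
    by_contra hne
    have h1 := zs_index_le I (I.sub_mem ha hb) (sub_ne_zero.2 hne)
    obtain ⟨e1, e2⟩ := Prod.ext_iff.1 hab
    have c1 := Int.abs_sub_lt_one_of_floor_eq_floor e1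
    have c2 := Int.abs_sub_lt_one_of_floor_eq_floor e2
    rw [← sub_div, abs_div, abs_of_pos hspos, div_lt_one hspos] at c1 c2
    rw [← mink_mul, mink_sub, abs_mul] at h1
    have : |(mink a).1 - (mink b).1| * |(mink a).2 - (mink b).2| < s * s :=
      mul_lt_mul'' c1 c2 (abs_nonneg _) (abs_nonneg _)
    simp only [Prod.fst_sub, Prod.snd_sub] at h1
    nlinarith
  have hcard := Set.ncard_le_ncard_of_injOn f hmaps hinj (Finset.finite_toSet _)
  rw [Set.ncard_coe_finset, Finset.card_product, Int.card_Icc] at hcard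
  have hc2 : (({a | a ∈ I ∧ a ≠ 0 ∧ a ∈ zsBall R}.ncard : ℕ) : ℝ) ≤ (2 * M + 2) * (2 * M + 2) := by
    have : (({a | a ∈ I ∧ a ≠ 0 ∧ a ∈ zsBall R}.ncard : ℕ) : ℤ) ≤ (2 * M + 2) * (2 * M + 2) := by
      have e : ((M + 1 - (-M - 1)).toNat : ℤ) = 2 * M + 2 := by
        rw [Int.toNat_of_nonneg (by omega)]; ring
      rw [← e]
      exact_mod_cast hcard
    exact_mod_cast this
  have hM0' : (1 : ℝ) ≤ M := by exact_mod_cast hM0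
  have h4 : (2 * M + 2 : ℝ) ≤ 4 * (R / s) := by linarith
  calc _ ≤ _ := hc2
    _ ≤ (4 * (R / s)) * (4 * (R / s)) := by gcongr
    _ = 16 * R ^ 2 * (1 / s ^ 2) := by field_simp; ring
    _ = _ := by rw [hs2]

open MeasureTheory in
theorem zs_ellipse_volume :
    volume.real {v : Fin 2 → ℝ | 2 * v 0 ^ 2 + 4 * v 1 ^ 2 < 1} = Real.pi / (2 * Real.sqrt 2) := by
  have hs2 : Real.sqrt 2 ^ 2 = 2 := Real.sq_sqrt (by norm_num)
  have hspos : 0 < Real.sqrt 2 := by positivity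
  let f : (Fin 2 → ℝ) →ₗ[ℝ] (Fin 2 → ℝ) := Matrix.toLin' (Matrix.diagonal ![Real.sqrt 2, 2])
  have hdet : LinearMap.det f = 2 * Real.sqrt 2 := by
    simp [f, LinearMap.det_toLin', mul_comm]
  have h1 : {v : Fin 2 → ℝ | 2 * v 0 ^ 2 + 4 * v 1 ^ 2 < 1} =
      f ⁻¹' ((@WithLp.toLp 2 (Fin 2 → ℝ)) ⁻¹' (Metric.ball (0 : EuclideanSpace ℝ (Fin 2)) 1)) := by
    rw [EuclideanSpace.ball_zero_eq _ zero_le_one]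
    ext v
    simp [f, Matrix.mulVec_diagonal, mul_pow, hs2]
    norm_num
  rw [Measure.real, h1, Measure.addHaar_preimage_linearMap _ (by rw [hdet]; positivity),
    (PiLp.volume_preserving_toLp (Fin 2)).measure_preimage
      measurableSet_ball.nullMeasurableSet, EuclideanSpace.volume_ball_fin_two, hdet]
  rw [ENNReal.toReal_mul, ENNReal.toReal_ofReal (abs_nonneg _), abs_of_pos (by positivity)]
  simp [Real.pi_pos.le]
  ring

open Pointwise in
theorem zs_scale (x : ℝ) (hx : 0 < x) :
    Nat.card ↑({v : Fin 2 → ℝ | 2 * v 0 ^ 2 + 4 * v 1 ^ 2 < 1} ∩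
      x⁻¹ • (Submodule.span ℤ (Set.range (Pi.basisFun ℝ (Fin 2))) : Set (Fin 2 → ℝ))) =
    (zsBall x).ncard := by
  let g : ℤ√2 → (Fin 2 → ℝ) := fun a => x⁻¹ • ![(a.re : ℝ), (a.im : ℝ)]
  have hg : Function.Injective g := by
    intro a b hab
    have h := smul_right_injective (Fin 2 → ℝ) (inv_ne_zero hx.ne') hab
    have h0 := congrFun h 0
    have h1 := congrFun h 1
    simp at h0 h1
    exact Zsqrtd.ext h0 h1
  have himg : ({v : Fin 2 → ℝ | 2 * v 0 ^ 2 + 4 * v 1 ^ 2 < 1} ∩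
      x⁻¹ • (Submodule.span ℤ (Set.range (Pi.basisFun ℝ (Fin 2))) : Set (Fin 2 → ℝ))) =
      g '' zsBall x := by
    have key : ∀ a : ℤ√2, g a ∈ {v : Fin 2 → ℝ | 2 * v 0 ^ 2 + 4 * v 1 ^ 2 < 1} ↔
        a ∈ zsBall x := by
      intro a
      simp only [zsBall, Set.mem_ofPred_eq, mink_sq]
      have : 2 * g a 0 ^ 2 + 4 * g a 1 ^ 2 = (2 * (a.re : ℝ) ^ 2 + 4 * (a.im : ℝ) ^ 2) / x ^ 2 := by
        simp [g]
        field_simp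
      rw [this, div_lt_one (by positivity)]
    ext v
    constructor
    · rintro ⟨hv, w, hw, rfl⟩
      have hw' := ((Pi.basisFun ℝ (Fin 2)).mem_span_iff_repr_mem ℤ w).1 hw
      obtain ⟨m, hm⟩ := hw' 0
      obtain ⟨n, hn⟩ := hw' 1
      have e : g ⟨m, n⟩ = x⁻¹ • w := by
        simp only [g]
        congr 1
        ext i
        fin_cases i
        · simpa using hm
        · simpa using hn
      refine ⟨⟨m, n⟩, (key _).1 ?_, e⟩
      rw [e]; exact hv
    · rintro ⟨a, ha, rfl⟩
      refine ⟨(key a).2 ha, _, ?_, rfl⟩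
      refine ((Pi.basisFun ℝ (Fin 2)).mem_span_iff_repr_mem ℤ _).2 ?_
      intro i
      fin_cases i
      · exact ⟨a.re, by simp⟩
      · exact ⟨a.im, by simp⟩
  rw [himg, Nat.card_coe_set_eq, Set.ncard_image_of_injective _ hg]

open MeasureTheory in
theorem zs_total : Tendsto (fun R : ℝ => ((zsBall R).ncard : ℝ) / (Real.pi * R ^ 2)) atTop
    (𝓝 (1 / (2 * Real.sqrt 2))) := by
  have hconv : Convex ℝ {v : Fin 2 → ℝ | 2 * v 0 ^ 2 + 4 * v 1 ^ 2 < 1} := by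
    intro v hv w hw a b ha hb hab
    simp only [Set.mem_ofPred_eq, Pi.add_apply, Pi.smul_apply, smul_eq_mul] at hv hw ⊢
    have hb' : b = 1 - a := by linarith
    subst hb'
    have : 2 * (a * v 0 + (1 - a) * w 0) ^ 2 + 4 * (a * v 1 + (1 - a) * w 1) ^ 2 =
      a * (2 * v 0 ^ 2 + 4 * v 1 ^ 2) + (1 - a) * (2 * w 0 ^ 2 + 4 * w 1 ^ 2)
      - a * (1 - a) * (2 * (v 0 - w 0) ^ 2 + 4 * (v 1 - w 1) ^ 2) := by ring
    rw [this]
    have h3 : 0 ≤ a * (1 - a) * (2 * (v 0 - w 0) ^ 2 + 4 * (v 1 - w 1) ^ 2) := by positivity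
    rcases eq_or_lt_of_le ha with h | h
    · subst h; linarith
    · nlinarith
  have hopen : IsOpen {v : Fin 2 → ℝ | 2 * v 0 ^ 2 + 4 * v 1 ^ 2 < 1} :=
    isOpen_lt (by fun_prop) (by fun_prop)
  have hbdd : Bornology.IsBounded {v : Fin 2 → ℝ | 2 * v 0 ^ 2 + 4 * v 1 ^ 2 < 1} := by
    apply (Metric.isBounded_closedBall (x := (0 : Fin 2 → ℝ)) (r := 1)).subset
    intro v hv
    simp only [Set.mem_ofPred_eq] at hv
    rw [mem_closedBall_zero_iff, pi_norm_le_iff_of_nonneg zero_le_one]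
    intro i
    rw [Real.norm_eq_abs]
    refine abs_le_of_sq_le_sq ?_ zero_le_one
    fin_cases i <;> simp only [Fin.zero_eta, Fin.mk_one] <;> nlinarith [sq_nonneg (v 0), sq_nonneg (v 1)]
  have h := tendsto_card_div_pow_atTop_volume'
    {v : Fin 2 → ℝ | 2 * v 0 ^ 2 + 4 * v 1 ^ 2 < 1} hbdd hopen.measurableSet
    (hconv.addHaar_frontier volume) (by
      intro x y hx hxy
      rintro _ ⟨v, hv, rfl⟩
      have hy : 0 < y := hx.trans_le hxy
      refine ⟨(x / y) • v, ?_, ?_⟩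
      · simp only [Set.mem_ofPred_eq, Pi.smul_apply, smul_eq_mul] at hv ⊢
        have h1 : (x / y) ^ 2 ≤ 1 := by
          apply pow_le_one₀ (by positivity) ((div_le_one hy).2 hxy)
        have h2 : 0 ≤ 2 * v 0 ^ 2 + 4 * v 1 ^ 2 := by positivity
        rw [mul_pow, mul_pow]
        nlinarith
      · simp only [smul_smul]
        congr 1
        field_simp)
  rw [zs_ellipse_volume] at h
  have h2 := h.const_mul (1 / Real.pi)
  have hpi := Real.pi_pos
  have e : 1 / Real.pi * (Real.pi / (2 * Real.sqrt 2)) = 1 / (2 * Real.sqrt 2) := by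
    field_simp
  rw [e] at h2
  refine h2.congr' ?_
  filter_upwards [eventually_gt_atTop 0] with x hx
  rw [zs_scale x hx]
  simp only [Fintype.card_fin]
  field_simp

theorem zs_total_shift (t : ℝ) :
    Tendsto (fun R : ℝ => ((zsBall (R + t)).ncard : ℝ) / (Real.pi * R ^ 2)) atTop
    (𝓝 (1 / (2 * Real.sqrt 2))) := by
  have h1 := zs_total.comp (tendsto_atTop_add_const_right atTop t tendsto_id)
  have h2 : Tendsto (fun R : ℝ => (1 + t / R) ^ 2) atTop (𝓝 ((1 + 0) ^ 2)) :=
    (tendsto_const_nhds.add (tendsto_const_nhds.div_atTop tendsto_id)).pow 2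
  have h3 := h1.mul h2
  rw [add_zero, one_pow, mul_one] at h3
  refine h3.congr' ?_
  filter_upwards [eventually_gt_atTop 0, eventually_gt_atTop (-t)] with R hR hRt
  have : 0 < R + t := by linarith
  have hpi := Real.pi_pos
  simp only [Function.comp, id]
  field_simp

theorem zs_translate (b : ℤ√2) : ∃ C : ℝ, 0 ≤ C ∧ ∀ R : ℝ, 0 ≤ R → ∀ a ∈ zsBall R,
    a + b ∈ zsBall (R + C) := by
  let z : ℤ√2 → ℂ := fun a => ⟨(mink a).1, (mink a).2⟩
  have hz : ∀ a, (mink a).1 ^ 2 + (mink a).2 ^ 2 = ‖z a‖ ^ 2 := by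
    intro a
    rw [← Complex.normSq_eq_norm_sq, Complex.normSq_apply]
    ring
  refine ⟨‖z b‖, norm_nonneg _, fun R hR a ha => ?_⟩
  simp only [zsBall, Set.mem_ofPred_eq, hz] at ha ⊢
  have h1 : ‖z a‖ < R := lt_of_pow_lt_pow_left₀ 2 hR ha
  have hadd : z (a + b) = z a + z b := by
    apply Complex.ext <;> simp [z, mink] <;> ring
  apply pow_lt_pow_left₀ _ (norm_nonneg _) (by norm_num)
  rw [hadd]
  linarith [norm_add_le (z a) (z b)]

theorem zs_equidist {Q : Type} [AddCommGroup Q] [Fintype Q] [DecidableEq Q] (φ : ℤ√2 →+ Q)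
    (hφ : Function.Surjective φ) (x : Q) :
    Tendsto (fun R : ℝ => ({a | φ a = x ∧ a ∈ zsBall R}.ncard : ℝ) / (Real.pi * R ^ 2)) atTop
      (𝓝 (1 / (2 * Real.sqrt 2) / Fintype.card Q)) := by
  have hfin : ∀ y R, {a | φ a = y ∧ a ∈ zsBall R}.Finite := fun y R =>
    (zsBall_finite R).subset (fun a ha => ha.2)
  -- comparison of fibres
  have hcmp : ∃ C : ℝ, 0 ≤ C ∧ ∀ y y' R, 0 ≤ R → {a | φ a = y ∧ a ∈ zsBall R}.ncard ≤
      {a | φ a = y' ∧ a ∈ zsBall (R + C)}.ncard := by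
    choose β hβ using hφ
    choose c hc0 hc using zs_translate
    refine ⟨∑ p : Q × Q, c (β p.2 - β p.1), Finset.sum_nonneg (fun _ _ => hc0 _), ?_⟩
    intro y y' R hR
    have hle : c (β y' - β y) ≤ ∑ p : Q × Q, c (β p.2 - β p.1) :=
      Finset.single_le_sum (f := fun p : Q × Q => c (β p.2 - β p.1)) (fun _ _ => hc0 _)
        (Finset.mem_univ (y, y'))
    refine Set.ncard_le_ncard_of_injOn (fun a => a + (β y' - β y)) ?_ ?_ (hfin _ _)
    · rintro a ⟨h1, h2⟩
      refine ⟨by simp [h1, hβ], ?_⟩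
      have := hc (β y' - β y) R hR a h2
      simp only [zsBall, Set.mem_ofPred_eq] at this ⊢
      refine this.trans_le ?_
      have := hc0 (β y' - β y)
      gcongr
    · intro a _ b _ h
      exact add_right_cancel h
  obtain ⟨C, hC0, hC⟩ := hcmp
  have hsum : ∀ R, (zsBall R).ncard = ∑ y : Q, {a | φ a = y ∧ a ∈ zsBall R}.ncard := by
    intro R
    have h := Finset.card_eq_sum_card_fiberwise (f := φ) (s := (zsBall_finite R).toFinset)
      (t := Finset.univ) (fun _ _ => by simp)
    rw [Set.ncard_eq_toFinset_card _ (zsBall_finite R), h]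
    refine Finset.sum_congr rfl fun y _ => ?_
    rw [Set.ncard_eq_toFinset_card _ (hfin y R)]
    congr 1
    ext a
    simp [and_comm]
  have hQ : (0 : ℝ) < Fintype.card Q := by
    exact_mod_cast Fintype.card_pos_iff.2 ⟨x⟩
  have hlow := (zs_total_shift (-C)).div_const (Fintype.card Q : ℝ)
  have hhigh := (zs_total_shift C).div_const (Fintype.card Q : ℝ)
  refine tendsto_of_tendsto_of_tendsto_of_le_of_le' hlow hhigh ?_ ?_
  · filter_upwards [eventually_gt_atTop C] with R hR
    have h1 : (zsBall (R + -C)).ncard ≤ Fintype.card Q * {a | φ a = x ∧ a ∈ zsBall R}.ncard := by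
      rw [hsum, ← smul_eq_mul, ← Finset.card_univ]
      apply Finset.sum_le_card_nsmul
      intro y _
      have := hC y x (R + -C) (by linarith)
      rwa [neg_add_cancel_right] at this
    have h2 : ((zsBall (R + -C)).ncard : ℝ) ≤
        Fintype.card Q * {a | φ a = x ∧ a ∈ zsBall R}.ncard := by exact_mod_cast h1
    rw [div_right_comm]
    have hpi := Real.pi_pos
    have hR0 : 0 < R := by linarith
    gcongr
    rw [div_le_iff₀ hQ]; linarith
  · filter_upwards [eventually_gt_atTop 0] with R hR
    have h1 : Fintype.card Q * {a | φ a = x ∧ a ∈ zsBall R}.ncard ≤ (zsBall (R + C)).ncard := by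
      rw [hsum, ← smul_eq_mul, ← Finset.card_univ]
      apply Finset.card_nsmul_le_sum
      intro y _
      exact hC x y R hR.le
    have h2 : Fintype.card Q * ({a | φ a = x ∧ a ∈ zsBall R}.ncard : ℝ) ≤
        (zsBall (R + C)).ncard := by exact_mod_cast h1
    rw [div_right_comm]
    have hpi := Real.pi_pos
    gcongr
    rw [le_div_iff₀ hQ]; linarith

theorem zs_finite_density (k : ℕ) (S : Finset ZsP) :
    Tendsto (fun R : ℝ => ({a : ℤ√2 | (∀ p ∈ S, a ∉ p.1 ^ k) ∧ a ∈ zsBall R}.ncard : ℝ) /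
      (Real.pi * R ^ 2)) atTop
      (𝓝 (1 / (2 * Real.sqrt 2) * ∏ p ∈ S, (1 - 1 / (Nat.card ((ℤ√2) ⧸ p.1) : ℝ) ^ k))) := by
  classical
  have hpos : ∀ p : ZsP, 0 < Nat.card ((ℤ√2) ⧸ p.1 ^ k) := fun p => by
    rw [zs_card_pow]; exact pow_pos (zs_card_pos p.1 p.2.2) k
  have hfinite : ∀ p : S, Finite ((ℤ√2) ⧸ p.1.1 ^ k) := fun p =>
    Nat.finite_of_card_ne_zero (hpos p.1).ne'
  let _ : ∀ p : S, Fintype ((ℤ√2) ⧸ p.1.1 ^ k) := fun p => Fintype.ofFinite _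
  let φ : ℤ√2 →+ (∀ p : S, (ℤ√2) ⧸ p.1.1 ^ k) :=
    (RingHom.pi (fun p : S => Ideal.Quotient.mk (p.1.1 ^ k))).toAddMonoidHom
  have hφa : ∀ a p, φ a p = Ideal.Quotient.mk (p.1.1 ^ k) a := fun a p => rfl
  have hφ : Function.Surjective φ := by
    intro x
    obtain ⟨r, hr⟩ := Ideal.pi_quotient_surjective (I := fun p : S => p.1.1 ^ k) (by
      intro p p' h
      exact zsP_coprime k (fun e => h (Subtype.ext e))) x
    exact ⟨r, funext hr⟩
  let G : Finset (∀ p : S, (ℤ√2) ⧸ p.1.1 ^ k) := Fintype.piFinset (fun p => Finset.univ.erase 0)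
  have hsum : ∀ R, {a : ℤ√2 | (∀ p ∈ S, a ∉ p.1 ^ k) ∧ a ∈ zsBall R}.ncard =
      ∑ x ∈ G, {a | φ a = x ∧ a ∈ zsBall R}.ncard := by
    intro R
    have hf1 : {a : ℤ√2 | (∀ p ∈ S, a ∉ p.1 ^ k) ∧ a ∈ zsBall R}.Finite :=
      (zsBall_finite R).subset (fun a ha => ha.2)
    have h := Finset.card_eq_sum_card_fiberwise (f := φ) (s := hf1.toFinset)
      (t := G) (fun a ha => by
        have ha' := hf1.mem_toFinset.1 ha
        simp only [G, Finset.mem_coe, Fintype.mem_piFinset, Finset.mem_erase, Finset.mem_univ,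
          and_true]
        intro p h0
        rw [hφa, Ideal.Quotient.eq_zero_iff_mem] at h0
        exact ha'.1 p.1 p.2 h0)
    rw [Set.ncard_eq_toFinset_card _ hf1, h]
    refine Finset.sum_congr rfl fun y hy => ?_
    have hf2 : {a | φ a = y ∧ a ∈ zsBall R}.Finite :=
      (zsBall_finite R).subset (fun a ha => ha.2)
    rw [Set.ncard_eq_toFinset_card _ hf2]
    congr 1
    ext a
    simp only [Finset.mem_filter, Set.Finite.mem_toFinset, Set.mem_ofPred_eq]
    constructor
    · rintro ⟨⟨-, h1⟩, h2⟩; exact ⟨h2, h1⟩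
    · rintro ⟨h2, h1⟩
      refine ⟨⟨fun p hp hmem => ?_, h1⟩, h2⟩
      have h3 := Finset.mem_erase.1 (Fintype.mem_piFinset.1 hy ⟨p, hp⟩)
      apply h3.1
      rw [← h2, hφa, Ideal.Quotient.eq_zero_iff_mem]
      exact hmem
  have hlim := tendsto_finsetSum G (fun x _ => zs_equidist φ hφ x)
  have hval : ∑ x ∈ G, 1 / (2 * Real.sqrt 2) / (Fintype.card (∀ p : S, (ℤ√2) ⧸ p.1.1 ^ k) : ℝ) =
      1 / (2 * Real.sqrt 2) * ∏ p ∈ S, (1 - 1 / (Nat.card ((ℤ√2) ⧸ p.1) : ℝ) ^ k) := by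
    rw [Finset.sum_const, nsmul_eq_mul, Fintype.card_pi, Fintype.card_piFinset,
      ← Finset.prod_coe_sort S]
    have h1 : ∀ p : S, 1 - 1 / (Nat.card ((ℤ√2) ⧸ p.1.1) : ℝ) ^ k =
        ((Finset.univ.erase (0 : (ℤ√2) ⧸ p.1.1 ^ k)).card : ℝ) /
          (Fintype.card ((ℤ√2) ⧸ p.1.1 ^ k) : ℝ) := by
      intro p
      have hc : Fintype.card ((ℤ√2) ⧸ p.1.1 ^ k) = Nat.card ((ℤ√2) ⧸ p.1.1) ^ k := by
        rw [← Nat.card_eq_fintype_card, zs_card_pow]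
      have hp : 0 < Nat.card ((ℤ√2) ⧸ p.1.1) ^ k := pow_pos (zs_card_pos p.1.1 p.1.2.2) k
      rw [Finset.card_erase_of_mem (Finset.mem_univ _), Finset.card_univ, hc, Nat.cast_sub hp]
      have : ((Nat.card ((ℤ√2) ⧸ p.1.1) ^ k : ℕ) : ℝ) ≠ 0 := by exact_mod_cast hp.ne'
      rw [sub_div, div_self this]
      push_cast
      rfl
    rw [Finset.prod_congr rfl (fun p _ => h1 p), Finset.prod_div_distrib]
    push_cast
    ring
  rw [hval] at hlim
  refine hlim.congr fun R => ?_
  rw [hsum, Nat.cast_sum, Finset.sum_div]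

theorem zs_tail (k : ℕ) (hk : 2 ≤ k) (S : Finset ZsP) (R : ℝ) (hR : 0 < R) :
    ({a : ℤ√2 | a ≠ 0 ∧ a ∈ zsBall R ∧ ∃ p : ZsP, p ∉ S ∧ a ∈ p.1 ^ k}.ncard : ℝ) ≤
      16 * R ^ 2 * ∑' p : {p : ZsP // p ∉ S}, 1 / (Nat.card ((ℤ√2) ⧸ p.1.1) : ℝ) ^ k := by
  classical
  set W := {a : ℤ√2 | a ≠ 0 ∧ a ∈ zsBall R ∧ ∃ p : ZsP, p ∉ S ∧ a ∈ p.1 ^ k} with hW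
  have hWf : W.Finite := (zsBall_finite R).subset (fun a ha => ha.2.1)
  have hEf : ∀ p : {p : ZsP // p ∉ S}, {a | a ∈ p.1.1 ^ k ∧ a ≠ 0 ∧ a ∈ zsBall R}.Finite :=
    fun p => (zsBall_finite R).subset (fun a ha => ha.2.2)
  have hch : ∀ a : W, ∃ p : {p : ZsP // p ∉ S}, a.1 ∈ p.1.1 ^ k := by
    rintro ⟨a, -, -, p, hp, hap⟩
    exact ⟨⟨p, hp⟩, hap⟩
  choose g hg using hch
  have := hWf.fintype
  let T : Finset {p : ZsP // p ∉ S} := Finset.univ.image g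
  have hsub : hWf.toFinset ⊆ T.biUnion (fun p => (hEf p).toFinset) := by
    intro a ha
    have ha' := hWf.mem_toFinset.1 ha
    rw [Finset.mem_biUnion]
    refine ⟨g ⟨a, ha'⟩, Finset.mem_image_of_mem _ (Finset.mem_univ _), ?_⟩
    rw [Set.Finite.mem_toFinset]
    exact ⟨hg ⟨a, ha'⟩, ha'.1, ha'.2.1⟩
  have hsummable : Summable fun p : {p : ZsP // p ∉ S} =>
      1 / (Nat.card ((ℤ√2) ⧸ p.1.1) : ℝ) ^ k :=
    (zsP_summable k hk).comp_injective Subtype.val_injective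
  have h1 : W.ncard ≤ ∑ p ∈ T, {a | a ∈ p.1.1 ^ k ∧ a ≠ 0 ∧ a ∈ zsBall R}.ncard := by
    rw [Set.ncard_eq_toFinset_card _ hWf]
    refine (Finset.card_le_card hsub).trans (Finset.card_biUnion_le.trans ?_)
    refine Finset.sum_le_sum fun p _ => ?_
    rw [Set.ncard_eq_toFinset_card _ (hEf p)]
  calc (W.ncard : ℝ) ≤ ∑ p ∈ T, ({a | a ∈ p.1.1 ^ k ∧ a ≠ 0 ∧ a ∈ zsBall R}.ncard : ℝ) := by
        exact_mod_cast h1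
    _ ≤ ∑ p ∈ T, 16 * R ^ 2 * (1 / (Nat.card ((ℤ√2) ⧸ p.1.1) : ℝ) ^ k) := by
        refine Finset.sum_le_sum fun p _ => ?_
        have := zs_ideal_count (p.1.1 ^ k) (pow_ne_zero k p.1.2.2) R hR
        rwa [zs_card_pow, Nat.cast_pow] at this
    _ = 16 * R ^ 2 * ∑ p ∈ T, (1 / (Nat.card ((ℤ√2) ⧸ p.1.1) : ℝ) ^ k) := by
        rw [Finset.mul_sum]
    _ ≤ _ := by
        gcongr
        exact hsummable.sum_le_tsum _ (fun _ _ => by positivity)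

theorem zs_sandwich (k : ℕ) (hk : 2 ≤ k) (S : Finset ZsP) (R : ℝ) (hR : 0 < R) :
    {a | a ∈ kfreeZsqrt2 k ∧ a ∈ zsBall R}.ncard ≤
      {a : ℤ√2 | (∀ p ∈ S, a ∉ p.1 ^ k) ∧ a ∈ zsBall R}.ncard ∧
    ({a : ℤ√2 | (∀ p ∈ S, a ∉ p.1 ^ k) ∧ a ∈ zsBall R}.ncard : ℝ) ≤
      {a | a ∈ kfreeZsqrt2 k ∧ a ∈ zsBall R}.ncard + 1 +
      16 * R ^ 2 * ∑' p : {p : ZsP // p ∉ S}, 1 / (Nat.card ((ℤ√2) ⧸ p.1.1) : ℝ) ^ k := by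
  constructor
  · refine Set.ncard_le_ncard ?_ ((zsBall_finite R).subset (fun a ha => ha.2))
    rintro a ⟨h1, h2⟩
    exact ⟨fun p _ => h1 p.1 p.2.1 p.2.2, h2⟩
  · have hsub : {a : ℤ√2 | (∀ p ∈ S, a ∉ p.1 ^ k) ∧ a ∈ zsBall R} ⊆
        ({a | a ∈ kfreeZsqrt2 k ∧ a ∈ zsBall R} ∪ {0}) ∪
        {a : ℤ√2 | a ≠ 0 ∧ a ∈ zsBall R ∧ ∃ p : ZsP, p ∉ S ∧ a ∈ p.1 ^ k} := by
      rintro a ⟨h1, h2⟩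
      by_cases h0 : a = 0
      · left; right; exact h0
      by_cases hf : a ∈ kfreeZsqrt2 k
      · left; left; exact ⟨hf, h2⟩
      right
      have hf' : ¬ ∀ 𝔭 : Ideal (ℤ√2), 𝔭.IsPrime → 𝔭 ≠ ⊥ → a ∉ 𝔭 ^ k := hf
      push Not at hf'
      obtain ⟨p, hp, hp0, hap⟩ := hf'
      exact ⟨h0, h2, ⟨p, hp, hp0⟩, fun hS => h1 _ hS hap, hap⟩
    have hfin : (({a | a ∈ kfreeZsqrt2 k ∧ a ∈ zsBall R} ∪ {0}) ∪
        {a : ℤ√2 | a ≠ 0 ∧ a ∈ zsBall R ∧ ∃ p : ZsP, p ∉ S ∧ a ∈ p.1 ^ k}).Finite :=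
      ((((zsBall_finite R).subset (fun a ha => ha.2)).union (Set.finite_singleton 0))).union
        ((zsBall_finite R).subset (fun a ha => ha.2.1))
    have h1 := Set.ncard_le_ncard hsub hfin
    have h2 := h1.trans (Set.ncard_union_le _ _)
    have h3 := h2.trans (Nat.add_le_add_right (Set.ncard_union_le _ _) _)
    rw [Set.ncard_singleton] at h3
    have h4 : ({a : ℤ√2 | (∀ p ∈ S, a ∉ p.1 ^ k) ∧ a ∈ zsBall R}.ncard : ℝ) ≤
      {a | a ∈ kfreeZsqrt2 k ∧ a ∈ zsBall R}.ncard + 1 +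
      {a : ℤ√2 | a ≠ 0 ∧ a ∈ zsBall R ∧ ∃ p : ZsP, p ∉ S ∧ a ∈ p.1 ^ k}.ncard := by
      exact_mod_cast h3
    linarith [zs_tail k hk S R hR]

/-- The natural density of the Minkowski embedding of the `k`-free integers of `ℚ(√2)`
(`k ≥ 2`) exists and equals `(1/(2√2)) ∏_𝔭 (1 − N(𝔭)⁻ᵏ) = (1/(2√2)) · 1/ζ_K(k)`, the
product running over all nonzero prime ideals `𝔭` of `ℤ[√2]`, with `N(𝔭) = (O_K : 𝔭)`
the absolute norm. -/
theorem kfree_Zsqrt2_density (k : ℕ) (hk : 2 ≤ k) :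
    Tendsto (fun R : ℝ =>
      (Nat.card {a : ℤ√2 // a ∈ kfreeZsqrt2 k ∧
        (mink a).1^2 + (mink a).2^2 < R^2} : ℝ) / (Real.pi * R^2))
      atTop
      (𝓝 (1 / (2 * Real.sqrt 2) *
        ∏' 𝔭 : {I : Ideal (ℤ√2) // I.IsPrime ∧ I ≠ ⊥},
          (1 - 1 / (Nat.card ((ℤ√2) ⧸ (𝔭 : Ideal (ℤ√2))) : ℝ)^k))) := by
  have hsm := zsP_summable k hk
  have hmul : Multipliable fun p : ZsP => 1 - 1 / (Nat.card ((ℤ√2) ⧸ p.1) : ℝ) ^ k := by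
    simpa [sub_eq_add_neg] using Real.multipliable_one_add_of_summable hsm.neg
  have hprod0 := hmul.hasProd
  rw [HasProd, SummationFilter.unconditional_filter] at hprod0
  have hprod := hprod0.const_mul (1 / (2 * Real.sqrt 2))
  have htail := (tendsto_tsum_compl_atTop_zero
    (fun p : ZsP => 1 / (Nat.card ((ℤ√2) ⧸ p.1) : ℝ) ^ k)).const_mul (16 / Real.pi)
  rw [mul_zero] at htail
  rw [Metric.tendsto_atTop] at hprod htail
  have hpi := Real.pi_pos
  rw [Metric.tendsto_nhds]
  intro ε hε
  obtain ⟨S1, hS1⟩ := hprod (ε / 4) (by positivity)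
  obtain ⟨S2, hS2⟩ := htail (ε / 4) (by positivity)
  classical
  have g1 := hS1 (S1 ∪ S2) Finset.subset_union_left
  have g2 := hS2 (S1 ∪ S2) Finset.subset_union_right
  generalize S1 ∪ S2 = S at g1 g2
  have g3 := Metric.tendsto_nhds.1 (zs_finite_density k S) (ε / 4) (by positivity)
  have hone : Tendsto (fun R : ℝ => 1 / (Real.pi * R ^ 2)) atTop (𝓝 0) :=
    tendsto_const_nhds.div_atTop
      (Tendsto.const_mul_atTop hpi (tendsto_pow_atTop (by norm_num)))
  have g4 := Metric.tendsto_nhds.1 hone (ε / 4) (by positivity)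
  filter_upwards [g3, g4, eventually_gt_atTop 0] with R h3 h4 hR
  obtain ⟨s1, s2⟩ := zs_sandwich k hk S R hR
  have hcard : Nat.card {a : ℤ√2 // a ∈ kfreeZsqrt2 k ∧
        (mink a).1^2 + (mink a).2^2 < R^2} =
      {a | a ∈ kfreeZsqrt2 k ∧ a ∈ zsBall R}.ncard := rfl
  rw [hcard]
  have hD : 0 < Real.pi * R ^ 2 := by positivity
  have s1' : ({a | a ∈ kfreeZsqrt2 k ∧ a ∈ zsBall R}.ncard : ℝ) / (Real.pi * R ^ 2) ≤
      ({a : ℤ√2 | (∀ p ∈ S, a ∉ p.1 ^ k) ∧ a ∈ zsBall R}.ncard : ℝ) / (Real.pi * R ^ 2) := by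
    gcongr
  have s2' : ({a : ℤ√2 | (∀ p ∈ S, a ∉ p.1 ^ k) ∧ a ∈ zsBall R}.ncard : ℝ) / (Real.pi * R ^ 2) ≤
      ({a | a ∈ kfreeZsqrt2 k ∧ a ∈ zsBall R}.ncard : ℝ) / (Real.pi * R ^ 2) +
      1 / (Real.pi * R ^ 2) + 16 / Real.pi *
        ∑' p : {p : ZsP // p ∉ S}, 1 / (Nat.card ((ℤ√2) ⧸ p.1.1) : ℝ) ^ k := by
    refine ((div_le_div_iff_of_pos_right hD).2 s2).trans (le_of_eq ?_)
    field_simp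
  rw [Real.dist_eq, abs_lt] at *
  constructor <;> linarith [g1.1, g1.2, g2.1, g2.2, h3.1, h3.2, h4.1, h4.2]
end
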